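/- arXiv:math/0409609 — 2 statements merged into one kernel-verified Lean document; each statement's English description precedes it below -/
import Mathlib

section
/- Let J, D, M be classes of filters, each assigning to every set a collection of filters on it. Assume M is projectable, J is F_1-composable, and J is (D,M)-steady on every set (for every set Z, every F ∈ J(Z) and H ∈ D(Z) with F # H one has F ∨ H ∈ M(Z)). Then J is (D,M)-composable: for all sets X and Y, every F ∈ J(X), and every H ∈ D(X×Y) meshing with the product filter F × Y, the filter HF on Y belongs to M(Y). -/
open Filter Set

universe u

/-- Two filters mesh if all their members intersect, i.e. the filter generated by
pairwise intersections (which is `F ⊓ G` in Mathlib's order) is proper. -/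
def Mesh {X : Type u} (F G : Filter X) : Prop := Filter.NeBot (F ⊓ G)

/-- The image filter `AF` of a filter `F` on `X` under a set `A ⊆ X × Y`:
generated by the sets `A(F) = {y | ∃ x ∈ F, (x, y) ∈ A}`. -/
def imgSet {X Y : Type u} (A : Set (X × Y)) (F : Filter X) : Filter Y :=
  ⨅ f ∈ F, 𝓟 {y | ∃ x ∈ f, (x, y) ∈ A}

/-- The image filter `HF` of a filter `F` on `X` under a filter `H` on `X × Y`:
generated by the sets `H(F) = {y | ∃ x ∈ F, (x, y) ∈ H}`, `H ∈ H`, `F ∈ F`. -/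
def imgFilter {X Y : Type u} (H : Filter (X × Y)) (F : Filter X) : Filter Y :=
  ⨅ h ∈ H, ⨅ f ∈ F, 𝓟 {y | ∃ x ∈ f, (x, y) ∈ h}

/-- A class of filters (one collection of filters on every set) is projectable if it is
stable under projections of products. -/
def Projectable (M : ∀ Z : Type u, Set (Filter Z)) : Prop :=
  ∀ (X Y : Type u), ∀ F ∈ M (X × Y), Filter.map Prod.snd F ∈ M Y

/-- A class of filters is `F_1`-composable if it is stable under images by (principal
filters of) relations. -/
def F1Composable (J : ∀ Z : Type u, Set (Filter Z)) : Prop :=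
  ∀ (X Y : Type u), ∀ F ∈ J X, ∀ A : Set (X × Y), imgSet A F ∈ J Y

theorem imgSet_graph_fst {X Y : Type u} (F : Filter X) :
    imgSet {p : X × (X × Y) | p.1 = p.2.1} F = F ×ˢ (⊤ : Filter Y) := by
  rw [prod_top, comap_eq_lift', Filter.lift', Filter.lift]
  simp [imgSet, preimage]

theorem mem_imgFilter {X Y : Type u} {H : Filter (X × Y)} {F : Filter X} {s : Set Y} :
    s ∈ imgFilter H F ↔ ∃ h ∈ H, ∃ f ∈ F, {y | ∃ x ∈ f, (x, y) ∈ h} ⊆ s := by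
  change s ∈ H.lift (fun h => F.lift' fun f => {y | ∃ x ∈ f, (x, y) ∈ h}) ↔ _
  have hmono (h : Set (X × Y)) : Monotone fun f : Set X => {y | ∃ x ∈ f, (x, y) ∈ h} :=
    fun _ _ hst _ ⟨x, hx, hxy⟩ => ⟨x, hst hx, hxy⟩
  rw [mem_lift_sets]
  · simp only [mem_lift'_sets (hmono _)]
  · exact fun h k hhk => lift'_mono le_rfl fun _ _ ⟨x, hx, hxy⟩ => ⟨x, hx, hhk hxy⟩

theorem imgFilter_eq_map_snd {X Y : Type u} (H : Filter (X × Y)) (F : Filter X) :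
    imgFilter H F = map Prod.snd ((F ×ˢ (⊤ : Filter Y)) ⊓ H) := by
  ext s
  rw [mem_imgFilter, mem_map, prod_top, mem_inf_iff_superset]
  constructor
  · rintro ⟨h, hh, f, hf, hs⟩
    exact ⟨_, preimage_mem_comap hf, h, hh, fun p hp => hs ⟨p.1, hp.1, hp.2⟩⟩
  · rintro ⟨t, ⟨f, hf, hft⟩, h, hh, hs⟩
    refine ⟨h, hh, f, hf, ?_⟩
    rintro y ⟨x, hx, hxy⟩
    exact hs (⟨hft hx, hxy⟩ : (x, y) ∈ t ∩ h)

theorem stmt7 (J D M : ∀ Z : Type u, Set (Filter Z))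
    (hM : Projectable M) (hJ : F1Composable J)
    (hsteady : ∀ (Z : Type u), ∀ F ∈ J Z, ∀ H ∈ D Z, Mesh F H → F ⊓ H ∈ M Z)
    (X Y : Type u) (F : Filter X) (hF : F ∈ J X)
    (H : Filter (X × Y)) (hH : H ∈ D (X × Y))
    (hmesh : Mesh H (F ×ˢ (⊤ : Filter Y))) :
    imgFilter H F ∈ M Y := by
  rw [imgFilter_eq_map_snd]
  refine hM X Y _ (hsteady _ _ ?_ H hH ?_)
  · rw [← imgSet_graph_fst]
    exact hJ X (X × Y) F hF _
  · rwa [Mesh, inf_comm]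
end

section
/- Let D be an F_1-composable class of filters and let J, M be classes of filters, each assigning to every set a collection of filters. Assume J is (D,M)-composable: for all sets X and Y, every F ∈ J(X) and every H ∈ D(X×Y) meshing with the product filter F × Y, the filter HF belongs to M(Y). Then for every proper filter F ∈ J(X) and every proper filter D ∈ D(Y), the product filter F × D belongs to M(X × Y). -/
open Filter Set

universe u

theorem mem_imgSet {X Y : Type u} {A : Set (X × Y)} {F : Filter X} {s : Set Y} :
    s ∈ imgSet A F ↔ ∃ f ∈ F, {y | ∃ x ∈ f, (x, y) ∈ A} ⊆ s :=
  mem_lift'_sets (h := fun f : Set X => {y | ∃ x ∈ f, (x, y) ∈ A})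
    fun _ _ hfg _ ⟨x, hx, hxy⟩ => ⟨x, hfg hx, hxy⟩

/-- The relation between `y` and the pairs `(x, (x, y))`; the image of a filter `G` on `Y` under
it composes with any filter `F` on `X` to give `F ×ˢ G`. -/
def pairingRel (X Y : Type u) : Set (Y × (X × (X × Y))) :=
  {p | p.2.1 = p.2.2.1 ∧ p.1 = p.2.2.2}

theorem imgFilter_imgSet_pairingRel {X Y : Type u} (F : Filter X) (G : Filter Y) :
    imgFilter (imgSet (pairingRel X Y) G) F = F ×ˢ G := by
  ext s
  rw [mem_imgFilter, mem_prod_iff]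
  constructor
  · rintro ⟨h, hh, f, hf, hs⟩
    obtain ⟨g, hg, hgh⟩ := mem_imgSet.1 hh
    exact ⟨f, hf, g, hg, fun p hp => hs ⟨p.1, hp.1, hgh ⟨p.2, hp.2, rfl, rfl⟩⟩⟩
  · rintro ⟨f, hf, g, hg, hs⟩
    refine ⟨_, mem_imgSet.2 ⟨g, hg, Subset.rfl⟩, f, hf, ?_⟩
    rintro ⟨a, b⟩ ⟨x, hx, y, hy, hxa, hyb⟩
    obtain rfl : x = a := hxa
    obtain rfl : y = b := hyb
    exact hs ⟨hx, hy⟩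

theorem mesh_imgSet_pairingRel {X Y : Type u} (F : Filter X) [F.NeBot] (G : Filter Y) [G.NeBot] :
    Mesh (imgSet (pairingRel X Y) G) (F ×ˢ (⊤ : Filter (X × Y))) := by
  refine inf_neBot_iff.2 fun s hs t ht => ?_
  obtain ⟨g, hg, hgs⟩ := mem_imgSet.1 hs
  obtain ⟨f, hf, u, hu, hfu⟩ := mem_prod_iff.1 ht
  obtain ⟨x, hx⟩ := Filter.nonempty_of_mem hf
  obtain ⟨y, hy⟩ := Filter.nonempty_of_mem hg
  refine ⟨(x, (x, y)), hgs ⟨y, hy, rfl, rfl⟩, hfu ⟨hx, ?_⟩⟩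
  rw [mem_top.1 hu]
  trivial

theorem stmt8 (J D M : ∀ Z : Type u, Set (Filter Z))
    (hD : F1Composable D)
    (hcomp : ∀ (X Y : Type u), ∀ F ∈ J X, ∀ H ∈ D (X × Y),
      Mesh H (F ×ˢ (⊤ : Filter Y)) → imgFilter H F ∈ M Y)
    (X Y : Type u) (F : Filter X) (hF : F ∈ J X) (hFproper : F.NeBot)
    (G : Filter Y) (hG : G ∈ D Y) (hGproper : G.NeBot) :
    F ×ˢ G ∈ M (X × Y) := by
  rw [← imgFilter_imgSet_pairingRel]
  exact hcomp _ _ F hF _ (hD _ _ G hG _) (mesh_imgSet_pairingRel F G)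
end
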